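/- arXiv:quant-ph/0702190 — 7 statements merged into one kernel-verified Lean document; each statement's English description precedes it below -/
import Mathlib

section
/- Let n ≥ 1 and let θ_k, φ_k (k = 1,…,n) be real numbers. Let |ψ⟩ = ⊗_{k=1}^n (cos(θ_k/2)|0⟩ + e^{iφ_k} sin(θ_k/2)|1⟩) be the corresponding n-qubit product state. For each binary string a ∈ {0,1}^n define the local unitary v_a = ⊗_{k=1}^n (X^{a_k} · s(φ_k)). Then ⟨ψ| v_a† v_b |ψ⟩ = δ_{ab} for all a, b ∈ {0,1}^n; hence every n-qubit product state is locally encodable. -/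
open Matrix

/-- Pauli X matrix. -/
noncomputable def Xg : Matrix (Fin 2) (Fin 2) ℂ := !![0, 1; 1, 0]

/-- The modified phase gate `s(φ) = !![1,0;0, i·e^{-iφ}]`. -/
noncomputable def sg (φ : ℝ) : Matrix (Fin 2) (Fin 2) ℂ :=
  !![1, 0; 0, Complex.I * Complex.exp (-(φ : ℂ) * Complex.I)]

/-- The `n`-fold tensor (Kronecker) product of single-qubit matrices, acting on
`(ℂ²)^{⊗n}` with computational basis indexed by binary strings `Fin n → Fin 2`. -/
noncomputable def tens {n : ℕ} (u : Fin n → Matrix (Fin 2) (Fin 2) ℂ) :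
    Matrix (Fin n → Fin 2) (Fin n → Fin 2) ℂ :=
  fun x y => ∏ k, u k (x k) (y k)

theorem sum_prod_aux {n : ℕ} (f : Fin n → Fin 2 → ℂ) :
    ∑ x : Fin n → Fin 2, ∏ k, f k (x k) = ∏ k, (f k 0 + f k 1) := by
  have h := Finset.prod_univ_sum (fun _ : Fin n => (Finset.univ : Finset (Fin 2))) f
  rw [Fintype.piFinset_univ] at h
  rw [← h]
  simp [Fin.sum_univ_two]

theorem tens_mulVec_aux {n : ℕ} (u : Fin n → Matrix (Fin 2) (Fin 2) ℂ) (q : Fin n → Fin 2 → ℂ) :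
    (tens u) *ᵥ (fun x => ∏ k, q k (x k)) = fun x => ∏ k, (u k *ᵥ q k) (x k) := by
  funext x
  simp only [Matrix.mulVec, dotProduct, tens, ← Finset.prod_mul_distrib, Fin.sum_univ_two]
  exact sum_prod_aux (fun k j => u k (x k) j * q k j)

theorem qubit_aux (θ φ : ℝ) (a : Fin 2) :
    (Xg ^ (a : ℕ) * sg φ) *ᵥ (fun j : Fin 2 => if j = 0 then (Real.cos (θ / 2) : ℂ)
       else Complex.exp ((φ : ℂ) * Complex.I) * (Real.sin (θ / 2) : ℂ))
      = fun j => if j = a then (Real.cos (θ / 2) : ℂ) else Complex.I * (Real.sin (θ / 2) : ℂ) := by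
  have h : Complex.exp (-(φ : ℂ) * Complex.I) * Complex.exp ((φ : ℂ) * Complex.I) = 1 := by
    rw [← Complex.exp_add]; simp
  have h2 : Complex.I * Complex.exp (-(φ : ℂ) * Complex.I) *
      (Complex.exp ((φ : ℂ) * Complex.I) * (Real.sin (θ / 2) : ℂ))
      = Complex.I * (Real.sin (θ / 2) : ℂ) := by
    linear_combination (Complex.I * (Real.sin (θ / 2) : ℂ)) * h
  have h3 : sg φ *ᵥ (fun j : Fin 2 => if j = 0 then (Real.cos (θ / 2) : ℂ)
       else Complex.exp ((φ : ℂ) * Complex.I) * (Real.sin (θ / 2) : ℂ))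
      = fun j => if j = 0 then (Real.cos (θ / 2) : ℂ) else Complex.I * (Real.sin (θ / 2) : ℂ) := by
    funext j
    simp only [Matrix.mulVec, dotProduct, Fin.sum_univ_two, if_true, one_ne_zero, if_false]
    fin_cases j
    · simp [sg]
    · simpa [sg] using h2
  rw [← Matrix.mulVec_mulVec, h3]
  funext j
  fin_cases a <;> fin_cases j <;> simp [Xg, Matrix.mulVec, dotProduct, Fin.sum_univ_two]

theorem overlap_aux (θ : ℝ) (a b : Fin 2) (w : Fin 2 → Fin 2 → ℂ)
    (hw : w = fun a j => if j = a then (Real.cos (θ / 2) : ℂ)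
      else Complex.I * (Real.sin (θ / 2) : ℂ)) :
    star (w a 0) * w b 0 + star (w a 1) * w b 1 = if a = b then 1 else 0 := by
  have h : (Real.sin (θ / 2) : ℂ) ^ 2 + (Real.cos (θ / 2) : ℂ) ^ 2 = 1 := by
    exact_mod_cast Real.sin_sq_add_cos_sq (θ / 2)
  have hI := Complex.I_sq
  subst hw
  generalize hs : Real.sin (θ / 2) = s at *
  generalize hc : Real.cos (θ / 2) = c at *
  fin_cases a <;> fin_cases b <;> simp [Complex.conj_ofReal] <;>
    first
    | (ring1; done)
    | linear_combination h - (s : ℂ) ^ 2 * hI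

/-- Every `n`-qubit product state `⊗ₖ (cos(θₖ/2)|0⟩ + e^{iφₖ} sin(θₖ/2)|1⟩)` is locally
encodable by the local unitaries `v_a = ⊗ₖ X^{aₖ}·s(φₖ)`, `a ∈ {0,1}ⁿ`:
`⟨ψ| v_a† v_b |ψ⟩ = δ_{ab}`. -/
theorem stmt1 (n : ℕ) (hn : 1 ≤ n) (θ φ : Fin n → ℝ)
    (ψ : (Fin n → Fin 2) → ℂ)
    (hψ : ψ = fun x => ∏ k,
      (if x k = 0 then (Real.cos (θ k / 2) : ℂ)
       else Complex.exp ((φ k : ℂ) * Complex.I) * (Real.sin (θ k / 2) : ℂ)))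
    (v : (Fin n → Fin 2) → Matrix (Fin n → Fin 2) (Fin n → Fin 2) ℂ)
    (hv : v = fun a => tens fun k => Xg ^ ((a k : ℕ)) * sg (φ k)) :
    ∀ a b : Fin n → Fin 2,
      star ψ ⬝ᵥ (((v a)ᴴ * v b) *ᵥ ψ) = if a = b then 1 else 0 := by
  intro a b
  set w : Fin n → Fin 2 → Fin 2 → ℂ := fun k a j => if j = a then (Real.cos (θ k / 2) : ℂ)
      else Complex.I * (Real.sin (θ k / 2) : ℂ) with hw
  have key : ∀ a, v a *ᵥ ψ = fun x => ∏ k, w k (a k) (x k) := by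
    intro a
    rw [hv, hψ]
    have := tens_mulVec_aux (fun k => Xg ^ ((a k : ℕ)) * sg (φ k))
      (fun k j => if j = 0 then (Real.cos (θ k / 2) : ℂ)
       else Complex.exp ((φ k : ℂ) * Complex.I) * (Real.sin (θ k / 2) : ℂ))
    refine this.trans ?_
    simp only [qubit_aux, hw]
  rw [← Matrix.mulVec_mulVec, Matrix.dotProduct_mulVec, ← Matrix.star_mulVec, key, key]
  simp only [dotProduct, Pi.star_apply, star_prod, ← Finset.prod_mul_distrib]
  rw [sum_prod_aux (fun k j => star (w k (a k) j) * w k (b k) j)]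
  rw [Finset.prod_congr rfl (fun k _ => overlap_aux (θ k) (a k) (b k) (w k) rfl)]
  rw [Finset.prod_ite_zero]
  simp [funext_iff]
end

section
/- Every two-qubit state is locally encodable: for every unit vector |ψ⟩ ∈ ℂ² ⊗ ℂ² there exist four local unitaries v_0, v_1, v_2, v_3 (each a tensor product of two 2×2 unitaries) such that ⟨ψ| v_i† v_j |ψ⟩ = δ_{ij} for all 0 ≤ i, j ≤ 3. -/
open Matrix Kronecker

lemma aux_vec (x y : ℂ) : ∃ (e f : ℂ) (r : ℝ), star e * e + star f * f = 1 ∧ x = r * e ∧ y = r * f := by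
  by_cases h : x = 0 ∧ y = 0
  · exact ⟨1, 0, 0, by simp, by simp [h.1], by simp [h.2]⟩
  · have hpos : 0 < Complex.normSq x + Complex.normSq y := by
      by_contra hn
      apply h
      have h1 := Complex.normSq_nonneg x
      have h2 := Complex.normSq_nonneg y
      exact ⟨Complex.normSq_eq_zero.1 (by linarith), Complex.normSq_eq_zero.1 (by linarith)⟩
    set r : ℝ := Real.sqrt (Complex.normSq x + Complex.normSq y) with hr
    have hr0 : (r : ℂ) ≠ 0 := by
      exact_mod_cast (Real.sqrt_pos.2 hpos).ne'
    have hr2 : (r : ℂ) * r = star x * x + star y * y := by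
      have : r * r = _ := Real.mul_self_sqrt hpos.le
      have h3 := congrArg (fun t : ℝ => (t : ℂ)) this
      simp only [Complex.ofReal_mul, Complex.ofReal_add, Complex.normSq_eq_conj_mul_self] at h3
      simpa using h3
    refine ⟨x / r, y / r, r, ?_, by field_simp, by field_simp⟩
    simp only [star_div₀, RCLike.star_def, Complex.conj_ofReal] at *
    field_simp
    rw [← hr2]; ring

lemma aux_phase (z : ℂ) : ∃ (p : ℂ) (r : ℝ), star p * p = 1 ∧ p * z = r := by
  obtain ⟨e, f, r, h1, h2, h3⟩ := aux_vec z 0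
  by_cases hr : r = 0
  · exact ⟨1, 0, by simp, by simp [h2, hr]⟩
  · have : f = 0 := by
      rcases mul_eq_zero.1 h3.symm with h | h
      · exact absurd (by exact_mod_cast h) hr
      · exact h
    subst this
    simp only [mul_zero, add_zero] at h1
    refine ⟨star e, r, by rw [star_star, mul_comm]; exact h1, ?_⟩
    rw [h2, mul_left_comm, h1, mul_one]

lemma aux_diag (N : Matrix (Fin 2) (Fin 2) ℂ) (h : (Nᴴ * N) 0 1 = 0) :
    ∃ W ∈ Matrix.unitaryGroup (Fin 2) ℂ, ∃ s t : ℝ, W * N = !![(s : ℂ), 0; 0, (t : ℂ)] := by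
  simp only [Matrix.mul_apply, Fin.sum_univ_two, conjTranspose_apply] at h
  by_cases h0 : N 0 0 = 0 ∧ N 1 0 = 0
  · obtain ⟨e, f, r, h1, h2, h3⟩ := aux_vec (N 0 1) (N 1 1)
    refine ⟨!![f, -e; star e, star f], ?_, 0, r, ?_⟩
    · rw [mem_unitaryGroup_iff]
      ext i j
      fin_cases i <;> fin_cases j <;> simp [Matrix.mul_apply, Fin.sum_univ_two] <;>
        simp at h1 <;> first | linear_combination h1 | linear_combination 0 * h1
    · ext i j
      fin_cases i <;> fin_cases j <;> simp [Matrix.mul_apply, Fin.sum_univ_two, h0.1, h0.2, h2, h3]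
      · ring
      · simp at h1; linear_combination r * h1
  · obtain ⟨e, f, r, h1, h2, h3⟩ := aux_vec (N 0 0) (N 1 0)
    obtain ⟨p, t, hp, ht⟩ := aux_phase (-f * N 0 1 + e * N 1 1)
    have hr : (r : ℂ) ≠ 0 := by
      intro hr; apply h0; simp [h2, h3, hr]
    have h4 : star e * N 0 1 + star f * N 1 1 = 0 := by
      apply mul_left_cancel₀ hr
      rw [h2, h3] at h
      simp only [star_mul', RCLike.star_def, Complex.conj_ofReal, mul_zero] at h ⊢
      linear_combination h
    refine ⟨!![star e, star f; -p * f, p * e], ?_, r, t, ?_⟩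
    · rw [mem_unitaryGroup_iff]
      simp at h1 hp
      ext i j
      fin_cases i <;> fin_cases j <;> simp [Matrix.mul_apply, Fin.sum_univ_two]
      · linear_combination h1
      · ring
      · ring
      · linear_combination (starRingEnd ℂ) p * p * h1 + hp
    · simp at h1 hp h4 ht
      ext i j
      fin_cases i <;> fin_cases j <;> simp [Matrix.mul_apply, Fin.sum_univ_two]
      · rw [h2, h3]; linear_combination r * h1
      · exact h4
      · rw [h2, h3]; ring
      · linear_combination ht

lemma aux_svd (M : Matrix (Fin 2) (Fin 2) ℂ) :
    ∃ W ∈ Matrix.unitaryGroup (Fin 2) ℂ, ∃ V ∈ Matrix.unitaryGroup (Fin 2) ℂ,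
    ∃ s t : ℝ, W * M * V = !![(s : ℂ), 0; 0, (t : ℂ)] := by
  have hH : (Mᴴ * M).IsHermitian := isHermitian_conjTranspose_mul_self M
  set V := hH.eigenvectorUnitary with hV
  have hd : ((M * V.1)ᴴ * (M * V.1)) 0 1 = 0 := by
    have h1 := hH.spectral_theorem
    rw [Unitary.conjStarAlgAut_apply] at h1
    have hVV : star V.1 * V.1 = 1 := Unitary.coe_star_mul_self V
    have : (M * V.1)ᴴ * (M * V.1) = diagonal (RCLike.ofReal ∘ hH.eigenvalues) := by
      calc _ = star V.1 * (Mᴴ * M) * V.1 := by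
            simp [conjTranspose_mul, Matrix.mul_assoc, star_eq_conjTranspose]
        _ = (star V.1 * V.1) * diagonal (RCLike.ofReal ∘ hH.eigenvalues) * (star V.1 * V.1) := by
            conv_lhs => rw [h1]
            simp only [Matrix.mul_assoc]; rfl
        _ = _ := by rw [hVV]; simp
    rw [this]; simp
  obtain ⟨W, hW, s, t, h⟩ := aux_diag _ hd
  exact ⟨W, hW, V.1, V.2, s, t, by rw [Matrix.mul_assoc, h]⟩

lemma aux_kron (u w : Matrix (Fin 2) (Fin 2) ℂ) (ψ : Fin 2 × Fin 2 → ℂ) (k : Fin 2 × Fin 2) :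
    ((u ⊗ₖ w) *ᵥ ψ) k = (u * (Matrix.of fun i j => ψ (i, j)) * wᵀ) k.1 k.2 := by
  simp [mulVec, dotProduct, Matrix.mul_apply, Fintype.sum_prod_type, Fin.sum_univ_two]
  ring

/-- Every two-qubit state is locally encodable: for every unit vector `|ψ⟩ ∈ ℂ²⊗ℂ²`
there exist four local unitaries `v_0,…,v_3` (tensor products of 2×2 unitaries) with
`⟨ψ| v_i† v_j |ψ⟩ = δ_{ij}`. -/
theorem stmt5 (ψ : Fin 2 × Fin 2 → ℂ) (hψ : star ψ ⬝ᵥ ψ = 1) :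
    ∃ v : Fin 4 → Matrix (Fin 2 × Fin 2) (Fin 2 × Fin 2) ℂ,
      (∀ i, ∃ u₁ u₂ : Matrix (Fin 2) (Fin 2) ℂ,
        u₁ ∈ Matrix.unitaryGroup (Fin 2) ℂ ∧ u₂ ∈ Matrix.unitaryGroup (Fin 2) ℂ ∧
        v i = u₁ ⊗ₖ u₂) ∧
      (∀ i j : Fin 4,
        star ψ ⬝ᵥ (((v i)ᴴ * v j) *ᵥ ψ) = if i = j then 1 else 0) := by
  obtain ⟨W, hW, V, hV, s, t, hD⟩ := aux_svd (Matrix.of fun i j => ψ (i, j))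
  have hVT : Vᵀ ∈ Matrix.unitaryGroup (Fin 2) ℂ := by
    rw [mem_unitaryGroup_iff]
    rw [mem_unitaryGroup_iff'] at hV
    have := congrArg transpose hV
    rw [transpose_mul, transpose_one] at this
    exact this
  let A : Fin 4 → Matrix (Fin 2) (Fin 2) ℂ :=
    ![1, !![0, 1; 1, 0], !![0, -1; 1, 0], !![1, 0; 0, -1]]
  let B : Fin 4 → Matrix (Fin 2) (Fin 2) ℂ :=
    ![1, 1, !![0, 1; 1, 0], !![0, 1; 1, 0]]
  have hA : ∀ i, A i ∈ Matrix.unitaryGroup (Fin 2) ℂ := by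
    intro i
    rw [mem_unitaryGroup_iff]
    fin_cases i <;> ext a b <;> fin_cases a <;> fin_cases b <;>
      simp [A, Matrix.mul_apply, Fin.sum_univ_two]
  have hB : ∀ i, B i ∈ Matrix.unitaryGroup (Fin 2) ℂ := by
    intro i
    rw [mem_unitaryGroup_iff]
    fin_cases i <;> ext a b <;> fin_cases a <;> fin_cases b <;>
      simp [B, Matrix.mul_apply, Fin.sum_univ_two]
  have hu : ∀ i, (A i * W) ⊗ₖ (B i * Vᵀ) ∈ Matrix.unitaryGroup (Fin 2 × Fin 2) ℂ := fun i =>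
    kronecker_mem_unitary (mul_mem (hA i) hW) (mul_mem (hB i) hVT)
  have key : ∀ i k, (((A i * W) ⊗ₖ (B i * Vᵀ)) *ᵥ ψ) k
      = (A i * !![(s : ℂ), 0; 0, (t : ℂ)] * (B i)ᵀ) k.1 k.2 := by
    intro i k
    rw [aux_kron, ← hD]
    simp only [transpose_mul, transpose_transpose, Matrix.mul_assoc]
  have inn : ∀ i j, star ψ ⬝ᵥ ((((A i * W) ⊗ₖ (B i * Vᵀ))ᴴ * ((A j * W) ⊗ₖ (B j * Vᵀ))) *ᵥ ψ)
      = ∑ k : Fin 2 × Fin 2, star ((A i * !![(s : ℂ), 0; 0, (t : ℂ)] * (B i)ᵀ) k.1 k.2)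
        * (A j * !![(s : ℂ), 0; 0, (t : ℂ)] * (B j)ᵀ) k.1 k.2 := by
    intro i j
    rw [← mulVec_mulVec, dotProduct_mulVec, ← star_mulVec]
    simp only [dotProduct, Pi.star_apply, key]
  have hst : (s : ℂ) * s + t * t = 1 := by
    have h0 := inn 0 0
    have h1 := mem_unitaryGroup_iff'.1 (hu 0)
    rw [star_eq_conjTranspose] at h1
    rw [h1, one_mulVec, hψ] at h0
    simp [A, B, Fintype.sum_prod_type, Fin.sum_univ_two] at h0
    exact h0.symm
  refine ⟨fun i => (A i * W) ⊗ₖ (B i * Vᵀ), fun i => ⟨_, _, mul_mem (hA i) hW,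
    mul_mem (hB i) hVT, rfl⟩, fun i j => ?_⟩
  rw [inn]
  fin_cases i <;> fin_cases j <;>
    simp [A, B, Fintype.sum_prod_type, Fin.sum_univ_two, Matrix.mul_apply] <;>
    first | linear_combination hst | linear_combination 0 * hst
end

section
/- The operator U_W = (1/√3)(X⊗Z⊗Z + I⊗X⊗Z + I⊗I⊗X) on (ℂ²)^{⊗3} is unitary, and U_W |000⟩ = (1/√3)(|100⟩ + |010⟩ + |001⟩), the three-qubit W state. -/
open Matrix Kronecker

/-- Pauli Z matrix. -/
noncomputable def Zg : Matrix (Fin 2) (Fin 2) ℂ := !![1, 0; 0, -1]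

/-- The computational basis of `(ℂ²)^{⊗3}`: `e3 a b c = |abc⟩`. -/
noncomputable def e3 (a b c : Fin 2) : Fin 2 × Fin 2 × Fin 2 → ℂ :=
  fun p => if p = (a, b, c) then 1 else 0

/-- `U_W = (1/√3)(X⊗Z⊗Z + I⊗X⊗Z + I⊗I⊗X)`. -/
noncomputable def UW : Matrix (Fin 2 × Fin 2 × Fin 2) (Fin 2 × Fin 2 × Fin 2) ℂ :=
  ((1 / Real.sqrt 3 : ℝ) : ℂ) •
    (Xg ⊗ₖ (Zg ⊗ₖ Zg) + (1 : Matrix (Fin 2) (Fin 2) ℂ) ⊗ₖ (Xg ⊗ₖ Zg)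
      + (1 : Matrix (Fin 2) (Fin 2) ℂ) ⊗ₖ ((1 : Matrix (Fin 2) (Fin 2) ℂ) ⊗ₖ Xg))

/-- `U_W` is unitary and maps `|000⟩` to the three-qubit W state
`(1/√3)(|100⟩+|010⟩+|001⟩)`. -/
theorem stmt7 :
    UWᴴ * UW = 1 ∧
    UW *ᵥ e3 0 0 0 = ((1 / Real.sqrt 3 : ℝ) : ℂ) • (e3 1 0 0 + e3 0 1 0 + e3 0 0 1) := by
  have hs : ((1 / Real.sqrt 3 : ℝ) : ℂ) * ((1 / Real.sqrt 3 : ℝ) : ℂ) = 1 / 3 := by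
    rw [← Complex.ofReal_mul, div_mul_div_comm, Real.mul_self_sqrt (by norm_num)]
    norm_num
  unfold UW
  generalize hc : (1 / Real.sqrt 3 : ℝ) = c at hs
  constructor
  · have hX : Xgᴴ = Xg := by
      ext i j; fin_cases i <;> fin_cases j <;> simp [Xg]
    have hZ : Zgᴴ = Zg := by
      ext i j; fin_cases i <;> fin_cases j <;> simp [Zg]
    have hXX : Xg * Xg = 1 := by
      ext i j; fin_cases i <;> fin_cases j <;> simp [Xg]
    have hZZ : Zg * Zg = 1 := by
      ext i j; fin_cases i <;> fin_cases j <;> simp [Zg]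
    have hZX : Zg * Xg = (-1 : ℂ) • (Xg * Zg) := by
      ext i j; fin_cases i <;> fin_cases j <;> simp [Zg, Xg]
    simp only [conjTranspose_smul, conjTranspose_add, conjTranspose_kronecker, hX, hZ,
      conjTranspose_one, smul_mul_smul_comm, RCLike.star_def, Complex.conj_ofReal, hs,
      add_mul, mul_add, ← mul_kronecker_mul, hXX, hZZ, hZX, one_mul, mul_one,
      one_kronecker_one, smul_kronecker, kronecker_smul]
    module
  · ext ⟨i, j, k⟩
    fin_cases i <;> fin_cases j <;> fin_cases k <;>
      simp [mulVec, dotProduct, e3, Xg, Zg, Matrix.one_apply]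
end

section
/- Let |W⟩ = (1/√3)(|100⟩ + |010⟩ + |001⟩) and |W'⟩ = (1/√3)(|011⟩ + |101⟩ + |110⟩). For each binary string a = (a_1,a_2,a_3) ∈ {0,1}³ set v_a = (X⊗I⊗I)^{a_1} (Z⊗X⊗I)^{a_2} (Z⊗Z⊗X)^{a_3}. Then ⟨W| v_a† v_b |W⟩ = δ_{ab} and ⟨W'| v_a† v_b |W'⟩ = δ_{ab} for all a, b ∈ {0,1}³; i.e., the 8 states v_a|W⟩ form an orthonormal basis of (ℂ²)^{⊗3}, and likewise for |W'⟩. -/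
open Matrix Kronecker

/-- The W state `(1/√3)(|100⟩+|010⟩+|001⟩)`. -/
noncomputable def Wst : Fin 2 × Fin 2 × Fin 2 → ℂ :=
  ((1 / Real.sqrt 3 : ℝ) : ℂ) • (e3 1 0 0 + e3 0 1 0 + e3 0 0 1)

/-- The flipped W state `(1/√3)(|011⟩+|101⟩+|110⟩)`. -/
noncomputable def Wst' : Fin 2 × Fin 2 × Fin 2 → ℂ :=
  ((1 / Real.sqrt 3 : ℝ) : ℂ) • (e3 0 1 1 + e3 1 0 1 + e3 1 1 0)

/-- The local encoders `v_a = (X⊗I⊗I)^{a₁}(Z⊗X⊗I)^{a₂}(Z⊗Z⊗X)^{a₃}`. -/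
noncomputable def vEnc (a : Fin 3 → Fin 2) :
    Matrix (Fin 2 × Fin 2 × Fin 2) (Fin 2 × Fin 2 × Fin 2) ℂ :=
  (Xg ⊗ₖ ((1 : Matrix (Fin 2) (Fin 2) ℂ) ⊗ₖ (1 : Matrix (Fin 2) (Fin 2) ℂ))) ^ ((a 0 : ℕ))
    * (Zg ⊗ₖ (Xg ⊗ₖ (1 : Matrix (Fin 2) (Fin 2) ℂ))) ^ ((a 1 : ℕ))
    * (Zg ⊗ₖ (Zg ⊗ₖ Xg)) ^ ((a 2 : ℕ))


lemma sum8 (f : Fin 2 × Fin 2 × Fin 2 → ℂ) : ∑ p, f p =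
    f (0,0,0) + f (0,0,1) + f (0,1,0) + f (0,1,1) + f (1,0,0) + f (1,0,1) + f (1,1,0)
      + f (1,1,1) := by
  simp only [Fintype.sum_prod_type, Fin.sum_univ_two]; ring

/-- vectors by their coordinates -/
noncomputable def mk8 (x0 x1 x2 x3 x4 x5 x6 x7 : ℂ) : Fin 2 × Fin 2 × Fin 2 → ℂ :=
  fun p => ![![![x0, x1], ![x2, x3]], ![![x4, x5], ![x6, x7]]] p.1 p.2.1 p.2.2

lemma act1 (x0 x1 x2 x3 x4 x5 x6 x7 : ℂ) :
    (Xg ⊗ₖ ((1 : Matrix (Fin 2) (Fin 2) ℂ) ⊗ₖ (1 : Matrix (Fin 2) (Fin 2) ℂ))) *ᵥ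
      mk8 x0 x1 x2 x3 x4 x5 x6 x7 = mk8 x4 x5 x6 x7 x0 x1 x2 x3 := by
  ext ⟨i, j, k⟩
  fin_cases i <;> fin_cases j <;> fin_cases k <;>
    simp [mulVec, dotProduct, sum8, mk8, Xg]

lemma act2 (x0 x1 x2 x3 x4 x5 x6 x7 : ℂ) :
    (Zg ⊗ₖ (Xg ⊗ₖ (1 : Matrix (Fin 2) (Fin 2) ℂ))) *ᵥ
      mk8 x0 x1 x2 x3 x4 x5 x6 x7 = mk8 x2 x3 x0 x1 (-x6) (-x7) (-x4) (-x5) := by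
  ext ⟨i, j, k⟩
  fin_cases i <;> fin_cases j <;> fin_cases k <;>
    simp [mulVec, dotProduct, sum8, mk8, Xg, Zg]

lemma act3 (x0 x1 x2 x3 x4 x5 x6 x7 : ℂ) :
    (Zg ⊗ₖ (Zg ⊗ₖ Xg)) *ᵥ
      mk8 x0 x1 x2 x3 x4 x5 x6 x7 = mk8 x1 x0 (-x3) (-x2) (-x5) (-x4) x7 x6 := by
  ext ⟨i, j, k⟩
  fin_cases i <;> fin_cases j <;> fin_cases k <;>
    simp [mulVec, dotProduct, sum8, mk8, Xg, Zg]

lemma W_eq : Wst = ((1 / Real.sqrt 3 : ℝ) : ℂ) • mk8 0 1 1 0 1 0 0 0 := by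
  unfold Wst; congr 1
  ext ⟨i, j, k⟩
  fin_cases i <;> fin_cases j <;> fin_cases k <;> simp [mk8, e3]

lemma W'_eq : Wst' = ((1 / Real.sqrt 3 : ℝ) : ℂ) • mk8 0 0 0 1 0 1 1 0 := by
  unfold Wst'; congr 1
  ext ⟨i, j, k⟩
  fin_cases i <;> fin_cases j <;> fin_cases k <;> simp [mk8, e3]

lemma red (A B : Matrix (Fin 2 × Fin 2 × Fin 2) (Fin 2 × Fin 2 × Fin 2) ℂ)
    (w : Fin 2 × Fin 2 × Fin 2 → ℂ) :
    star (((1 / Real.sqrt 3 : ℝ) : ℂ) • w) ⬝ᵥ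
      ((Aᴴ * B) *ᵥ (((1 / Real.sqrt 3 : ℝ) : ℂ) • w)) =
    (1 / 3 : ℂ) * (star (A *ᵥ w) ⬝ᵥ (B *ᵥ w)) := by
  have h : ((1 / Real.sqrt 3 : ℝ) : ℂ) * ((1 / Real.sqrt 3 : ℝ) : ℂ) = 1 / 3 := by
    rw [← Complex.ofReal_mul, div_mul_div_comm, Real.mul_self_sqrt (by norm_num)]
    norm_num
  rw [star_mulVec, ← dotProduct_mulVec, mulVec_mulVec, mulVec_smul, star_smul,
    smul_dotProduct, dotProduct_smul, smul_smul, ← h, smul_eq_mul]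
  congr 2
  exact Complex.conj_ofReal _

lemma dot8 (x0 x1 x2 x3 x4 x5 x6 x7 y0 y1 y2 y3 y4 y5 y6 y7 : ℂ) :
    star (mk8 x0 x1 x2 x3 x4 x5 x6 x7) ⬝ᵥ mk8 y0 y1 y2 y3 y4 y5 y6 y7 =
    star x0 * y0 + star x1 * y1 + star x2 * y2 + star x3 * y3 + star x4 * y4 + star x5 * y5
      + star x6 * y6 + star x7 * y7 := by
  simp [dotProduct, sum8, mk8]

lemma eq3 (a : Fin 3 → Fin 2) : a = ![a 0, a 1, a 2] := by
  ext i; fin_cases i <;> rfl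

lemma vec_eq (a b c d e f : Fin 2) :
    (![a, b, c] = ![d, e, f]) ↔ (a = d ∧ b = e ∧ c = f) := by
  simp

lemma vmul (a b c : Fin 2) (w : Fin 2 × Fin 2 × Fin 2 → ℂ) : vEnc ![a, b, c] *ᵥ w =
    (Xg ⊗ₖ ((1 : Matrix (Fin 2) (Fin 2) ℂ) ⊗ₖ (1 : Matrix (Fin 2) (Fin 2) ℂ))) ^ (a : ℕ) *ᵥ
     ((Zg ⊗ₖ (Xg ⊗ₖ (1 : Matrix (Fin 2) (Fin 2) ℂ))) ^ (b : ℕ) *ᵥ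
      ((Zg ⊗ₖ (Zg ⊗ₖ Xg)) ^ (c : ℕ) *ᵥ w)) := by
  simp only [mulVec_mulVec, vEnc, mul_assoc]; rfl

lemma p0 (A : Matrix (Fin 2 × Fin 2 × Fin 2) (Fin 2 × Fin 2 × Fin 2) ℂ)
    (w : Fin 2 × Fin 2 × Fin 2 → ℂ) : A ^ ((0 : Fin 2) : ℕ) *ᵥ w = w := by simp

lemma p1 (A : Matrix (Fin 2 × Fin 2 × Fin 2) (Fin 2 × Fin 2 × Fin 2) ℂ)
    (w : Fin 2 × Fin 2 × Fin 2 → ℂ) : A ^ ((1 : Fin 2) : ℕ) *ᵥ w = A *ᵥ w := by simp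

lemma all2 {P : Fin 2 → Prop} (h0 : P 0) (h1 : P 1) (a : Fin 2) : P a := by
  fin_cases a
  exacts [h0, h1]

set_option maxHeartbeats 4000000 in
/-- The 8 operators `v_a`, `a ∈ {0,1}³`, locally encode both `|W⟩` and `|W'⟩`:
`⟨W| v_a† v_b |W⟩ = δ_{ab}` and `⟨W'| v_a† v_b |W'⟩ = δ_{ab}`. -/
theorem stmt9 :
    (∀ a b : Fin 3 → Fin 2,
      star Wst ⬝ᵥ (((vEnc a)ᴴ * vEnc b) *ᵥ Wst) = if a = b then 1 else 0) ∧
    (∀ a b : Fin 3 → Fin 2,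
      star Wst' ⬝ᵥ (((vEnc a)ᴴ * vEnc b) *ᵥ Wst') = if a = b then 1 else 0) := by
  constructor
  all_goals
    intro a b
    rw [eq3 a, eq3 b]
    first | rw [W_eq] | rw [W'_eq]
    rw [red]
    simp only [vmul, vec_eq]
    generalize a 0 = a0
    generalize a 1 = a1
    generalize a 2 = a2
    generalize b 0 = b0
    generalize b 1 = b1
    generalize b 2 = b2
    induction a0 using all2 <;> induction a1 using all2 <;> induction a2 using all2 <;>
    induction b0 using all2 <;> induction b1 using all2 <;> induction b2 using all2 <;>
    simp only [p0, p1, act1, act2, act3, dot8] <;> norm_num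
end

section
/- Let n ≥ 1 and for 1 ≤ i ≤ n define the n-qubit operators p_i = I^{⊗(i-1)} ⊗ X ⊗ Z^{⊗(n-i)} and g_i = Z^{⊗(i-1)} ⊗ X ⊗ I^{⊗(n-i)}. Then: (i) p_i p_j = −p_j p_i for all i ≠ j (the p_i pairwise anticommute), and (ii) p_i g_j = g_j p_i for all i, j (every p_i commutes with every g_j). -/
open Matrix

/-- `p_i = I^{⊗(i-1)} ⊗ X ⊗ Z^{⊗(n-i)}`. -/
noncomputable def pOp {n : ℕ} (i : Fin n) :
    Matrix (Fin n → Fin 2) (Fin n → Fin 2) ℂ :=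
  tens fun k => if k < i then 1 else if k = i then Xg else Zg

/-- `g_i = Z^{⊗(i-1)} ⊗ X ⊗ I^{⊗(n-i)}`. -/
noncomputable def gOp {n : ℕ} (i : Fin n) :
    Matrix (Fin n → Fin 2) (Fin n → Fin 2) ℂ :=
  tens fun k => if k < i then Zg else if k = i then Xg else 1

lemma tens_mul {n : ℕ} (u v : Fin n → Matrix (Fin 2) (Fin 2) ℂ) :
    tens u * tens v = tens (fun k => u k * v k) := by
  ext x y
  simp only [tens, Matrix.mul_apply, ← Finset.prod_mul_distrib]
  rw [Finset.prod_univ_sum]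
  simp [Fintype.piFinset_univ]

lemma tens_comm {n : ℕ} (u v : Fin n → Matrix (Fin 2) (Fin 2) ℂ) (c : Fin n → ℂ)
    (h : ∀ k, u k * v k = c k • (v k * u k)) :
    tens u * tens v = (∏ k, c k) • (tens v * tens u) := by
  rw [tens_mul, tens_mul]
  ext x y
  simp [tens, h, Finset.prod_mul_distrib]

lemma XZ : Xg * Zg = - (Zg * Xg) := by
  ext i j; fin_cases i <;> fin_cases j <;> simp [Xg, Zg]

lemma pp_lt {n : ℕ} (i j : Fin n) (h : i < j) : pOp i * pOp j = -(pOp j * pOp i) := by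
  unfold pOp
  rw [tens_comm _ _ (fun k => if k = j then -1 else 1)]
  · simp
  · intro k
    rcases lt_trichotomy k i with h1 | h1 | h1 <;> rcases lt_trichotomy k j with h2 | h2 | h2 <;>
      first
      | (exfalso; omega)
      | simp [h1, h2, h1.not_gt, h1.ne', h2.not_gt, h2.ne', h2.ne, XZ]
      | (subst h1; simp [h2, h2.ne, XZ])
      | (subst h2; simp [h1.not_gt, h1.ne', XZ])

/-- The `p_i` pairwise anticommute, and every `p_i` commutes with every `g_j`. -/
theorem stmt10 (n : ℕ) (hn : 1 ≤ n) :
    (∀ i j : Fin n, i ≠ j → pOp i * pOp j = -(pOp j * pOp i)) ∧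
    (∀ i j : Fin n, pOp i * gOp j = gOp j * pOp i) := by
  refine ⟨fun i j hij => ?_, fun i j => ?_⟩
  · rcases lt_or_gt_of_ne hij with h | h
    · exact pp_lt i j h
    · rw [pp_lt j i h, neg_neg]
  · unfold pOp gOp
    by_cases h : i < j
    · rw [tens_comm _ _ (fun k => (if k = i then -1 else 1) * (if k = j then -1 else 1))]
      · rw [Finset.prod_mul_distrib]; simp
      · intro k
        rcases lt_trichotomy k i with h1 | h1 | h1 <;>
          rcases lt_trichotomy k j with h2 | h2 | h2 <;>
        first
        | (exfalso; omega)
        | (subst h1; simp [h2, h2.ne, XZ]; done)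
        | (subst h2; simp [h1.not_gt, h1.ne', XZ]; done)
        | (simp [h1, h2, h1.not_gt, h1.ne', h1.ne, h2.not_gt, h2.ne', h2.ne, XZ]; done)
        | (have := h1.ne; have := h2.ne'; simp [*, h1.not_gt, h2.not_gt]; done)
        | (have := h1.ne'; have := h2.ne'; simp [*, h1.not_gt, h2.not_gt]; done)
    · rw [tens_comm _ _ (fun k => 1)]
      · simp
      · intro k
        rcases lt_trichotomy k i with h1 | h1 | h1 <;>
          rcases lt_trichotomy k j with h2 | h2 | h2 <;>
        first
        | (exfalso; omega)
        | (subst h1; subst h2; simp; done)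
        | (subst h1; simp [h2.not_gt, h2.ne']; done)
        | (subst h2; simp [h1]; done)
        | (simp [h1, h2, h1.not_gt, h1.ne', h2.not_gt, h2.ne']; done)
        | (simp [h1, h2, h2.not_gt, h2.ne']; done)
        | (simp [h1, h2]; done)
end

section
/- (Inductive method.) Let |φ_0⟩ and |φ_1⟩ be n-qubit unit vectors and let {v_i}_{i=1}^{2^n} be unitaries on ℂ^{2^n} such that ⟨φ_x| v_i† v_j |φ_x⟩ = δ_{ij} for x = 0, 1 and all i, j. Let |ψ⟩ = (1/√2)(|0⟩ ⊗ |φ_0⟩ + |1⟩ ⊗ |φ_1⟩). Then for all a, b ∈ {0,1} and all i, j, ⟨ψ| (Z^a ⊗ v_i)† (Z^b ⊗ v_j) |ψ⟩ = δ_{ab} δ_{ij}; i.e., the family {I ⊗ v_i, Z ⊗ v_i} of 2^{n+1} operators encodes the (n+1)-qubit state |ψ⟩. -/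
open Matrix Kronecker

theorem quad_aux (n : ℕ) (φ₀ φ₁ : (Fin n → Fin 2) → ℂ) (c : ℝ)
    (D : Matrix (Fin 2) (Fin 2) ℂ) (h01 : D 0 1 = 0) (h10 : D 1 0 = 0)
    (M : Matrix (Fin n → Fin 2) (Fin n → Fin 2) ℂ)
    (ψ : Fin 2 × (Fin n → Fin 2) → ℂ)
    (hψ : ψ = fun p => (c : ℂ) * (if p.1 = 0 then φ₀ p.2 else φ₁ p.2)) :
    star ψ ⬝ᵥ ((D ⊗ₖ M) *ᵥ ψ) =
      (c : ℂ) ^ 2 * (D 0 0 * (star φ₀ ⬝ᵥ (M *ᵥ φ₀)) + D 1 1 * (star φ₁ ⬝ᵥ (M *ᵥ φ₁))) := by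
  subst hψ
  simp only [dotProduct, mulVec, Fintype.sum_prod_type, Fin.sum_univ_two, kroneckerMap_apply,
    Pi.star_apply, h01, h10, Finset.mul_sum, mul_add, zero_mul, mul_zero, Finset.sum_const_zero,
    add_zero, zero_add, star_mul', if_true, one_ne_zero, if_false, Complex.star_def,
    Complex.conj_ofReal]
  congr 1 <;>
  · refine Finset.sum_congr rfl fun x _ => Finset.sum_congr rfl fun y _ => ?_
    ring

/-- Inductive method: if `|φ₀⟩` and `|φ₁⟩` are `n`-qubit unit vectors both encoded by
the same family of unitaries `{v_i}`, then `|ψ⟩ = (|0⟩⊗|φ₀⟩ + |1⟩⊗|φ₁⟩)/√2` is encoded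
by the family `{Z^a ⊗ v_i : a ∈ {0,1}}`:
`⟨ψ| (Z^a ⊗ v_i)† (Z^b ⊗ v_j) |ψ⟩ = δ_{ab} δ_{ij}`. -/
theorem stmt14 (n : ℕ) (φ₀ φ₁ : (Fin n → Fin 2) → ℂ)
    (hφ₀ : star φ₀ ⬝ᵥ φ₀ = 1) (hφ₁ : star φ₁ ⬝ᵥ φ₁ = 1)
    (v : Fin (2 ^ n) → Matrix (Fin n → Fin 2) (Fin n → Fin 2) ℂ)
    (hvU : ∀ i, v i ∈ Matrix.unitaryGroup (Fin n → Fin 2) ℂ)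
    (hv₀ : ∀ i j, star φ₀ ⬝ᵥ (((v i)ᴴ * v j) *ᵥ φ₀) = if i = j then 1 else 0)
    (hv₁ : ∀ i j, star φ₁ ⬝ᵥ (((v i)ᴴ * v j) *ᵥ φ₁) = if i = j then 1 else 0)
    (ψ : Fin 2 × (Fin n → Fin 2) → ℂ)
    (hψ : ψ = fun p => ((1 / Real.sqrt 2 : ℝ) : ℂ) *
      (if p.1 = 0 then φ₀ p.2 else φ₁ p.2)) :
    ∀ (a b : Fin 2) (i j : Fin (2 ^ n)),
      star ψ ⬝ᵥ ((((Zg ^ (a : ℕ)) ⊗ₖ v i)ᴴ * ((Zg ^ (b : ℕ)) ⊗ₖ v j)) *ᵥ ψ)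
        = if a = b ∧ i = j then 1 else 0 := by
  intro a b i j
  have hc : (((1 / Real.sqrt 2 : ℝ) : ℂ)) ^ 2 = 1 / 2 := by
    rw [← Complex.ofReal_pow, div_pow, Real.sq_sqrt (by norm_num)]
    norm_num
  rw [conjTranspose_kronecker, ← mul_kronecker_mul,
    quad_aux n φ₀ φ₁ (1 / Real.sqrt 2) _ ?_ ?_ _ ψ hψ, hv₀, hv₁, hc]
  · by_cases hij : i = j <;> fin_cases a <;> fin_cases b <;>
      norm_num [hij, Zg, Matrix.mul_apply, Fin.sum_univ_two, conjTranspose_apply]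
  · fin_cases a <;> fin_cases b <;>
      simp [Zg, Matrix.mul_apply, Fin.sum_univ_two, conjTranspose_apply]
  · fin_cases a <;> fin_cases b <;>
      simp [Zg, Matrix.mul_apply, Fin.sum_univ_two, conjTranspose_apply]
end

section
/- Let |4,2⟩ = (1/√6)(|0011⟩+|0101⟩+|0110⟩+|1001⟩+|1010⟩+|1100⟩). For a = (a_1,a_2,a_3) ∈ {0,1}³ set v_a = (X⊗I⊗I)^{a_1} (Z⊗X⊗I)^{a_2} (Z⊗Z⊗X)^{a_3}. Then for all b, b' ∈ {0,1} and a, a' ∈ {0,1}³, ⟨4,2| (Z^b ⊗ v_a)† (Z^{b'} ⊗ v_{a'}) |4,2⟩ = δ_{bb'} δ_{aa'}; i.e., the 16 local unitaries {I ⊗ v_a, Z ⊗ v_a} locally encode the four-qubit symmetric basis state |4,2⟩. -/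
open Matrix Kronecker

/-- The computational basis of `(ℂ²)^{⊗4}`: `e4 a b c d = |abcd⟩`. -/
noncomputable def e4 (a b c d : Fin 2) : Fin 2 × Fin 2 × Fin 2 × Fin 2 → ℂ :=
  fun p => if p = (a, b, c, d) then 1 else 0

/-- The four-qubit symmetric basis state
`|4,2⟩ = (1/√6)(|0011⟩+|0101⟩+|0110⟩+|1001⟩+|1010⟩+|1100⟩)`. -/
noncomputable def sym42 : Fin 2 × Fin 2 × Fin 2 × Fin 2 → ℂ :=
  ((1 / Real.sqrt 6 : ℝ) : ℂ) •
    (e4 0 0 1 1 + e4 0 1 0 1 + e4 0 1 1 0 + e4 1 0 0 1 + e4 1 0 1 0 + e4 1 1 0 0)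

namespace Sub15

def Xz : Matrix (Fin 2) (Fin 2) ℤ := fun i j => if i = j then 0 else 1
def Zz : Matrix (Fin 2) (Fin 2) ℤ := fun i j => if i = j then (if i = 0 then 1 else -1) else 0

def Uz (b a0 a1 a2 : Fin 2) :
    Matrix (Fin 2 × Fin 2 × Fin 2 × Fin 2) (Fin 2 × Fin 2 × Fin 2 × Fin 2) ℤ :=
  (Zz ^ (b : ℕ)) ⊗ₖ ((Xz ^ (a0 : ℕ) * Zz ^ (a1 : ℕ) * Zz ^ (a2 : ℕ)) ⊗ₖ
    ((Xz ^ (a1 : ℕ) * Zz ^ (a2 : ℕ)) ⊗ₖ (Xz ^ (a2 : ℕ))))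

def w (p : Fin 2 × Fin 2 × Fin 2 × Fin 2) : ℤ :=
  if (p.1 : ℕ) + p.2.1 + p.2.2.1 + p.2.2.2 = 2 then 1 else 0

def sg (n : Fin 2) : ℤ := if n = 0 then 1 else -1

def f (b a0 a1 a2 : Fin 2) (p : Fin 2 × Fin 2 × Fin 2 × Fin 2) : ℤ :=
  sg (b * p.1) * sg (a1 * (p.2.1 + a0)) * sg (a2 * (p.2.1 + a0 + p.2.2.1 + a1)) *
    w (p.1, p.2.1 + a0, p.2.2.1 + a1, p.2.2.2 + a2)

lemma Uz_w : ∀ b a0 a1 a2 p, (Uz b a0 a1 a2 *ᵥ w) p = f b a0 a1 a2 p := by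
  decide +kernel

lemma ff : ∀ b a0 a1 a2 b' a0' a1' a2', ∑ p, f b a0 a1 a2 p * f b' a0' a1' a2' p =
    if b = b' ∧ a0 = a0' ∧ a1 = a1' ∧ a2 = a2' then 6 else 0 := by
  decide +kernel

lemma Xg_eq : Xg = Xz.map (Int.castRingHom ℂ) := by
  ext i j; fin_cases i <;> fin_cases j <;> simp [Xg, Xz]

lemma Zg_eq : Zg = Zz.map (Int.castRingHom ℂ) := by
  ext i j; fin_cases i <;> fin_cases j <;> simp [Zg, Zz]

lemma kpow {m n : Type} [Fintype m] [Fintype n] [DecidableEq m] [DecidableEq n]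
    (A : Matrix m m ℂ) (B : Matrix n n ℂ) (k : ℕ) : (A ⊗ₖ B) ^ k = (A ^ k) ⊗ₖ (B ^ k) := by
  induction k with
  | zero => simp
  | succ k ih => rw [pow_succ, pow_succ, pow_succ, ih, Matrix.mul_kronecker_mul]

lemma kmap {m n : Type} (A : Matrix m m ℤ) (B : Matrix n n ℤ) :
    (A ⊗ₖ B).map (Int.castRingHom ℂ) =
      (A.map (Int.castRingHom ℂ)) ⊗ₖ (B.map (Int.castRingHom ℂ)) := by
  ext i j; simp

lemma pmap {m : Type} [Fintype m] [DecidableEq m] (A : Matrix m m ℤ) (k : ℕ) :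
    (A ^ k).map (Int.castRingHom ℂ) = (A.map (Int.castRingHom ℂ)) ^ k := by
  exact map_pow (Int.castRingHom ℂ).mapMatrix A k

lemma U_eq (b : Fin 2) (a : Fin 3 → Fin 2) :
    (Zg ^ (b : ℕ)) ⊗ₖ vEnc a = (Uz b (a 0) (a 1) (a 2)).map (Int.castRingHom ℂ) := by
  simp only [Uz, kmap, Matrix.map_mul, pmap, ← Xg_eq, ← Zg_eq, vEnc, kpow,
    ← Matrix.mul_kronecker_mul, one_pow, one_mul]

lemma sym_eq : sym42 = ((1 / Real.sqrt 6 : ℝ) : ℂ) • (fun p => (w p : ℂ)) := by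
  unfold sym42
  congr 1
  ext ⟨i, j, k, l⟩
  fin_cases i <;> fin_cases j <;> fin_cases k <;> fin_cases l <;> simp [e4, w]

lemma U_sym (b : Fin 2) (a : Fin 3 → Fin 2) :
    ((Zg ^ (b : ℕ)) ⊗ₖ vEnc a) *ᵥ sym42 =
      ((1 / Real.sqrt 6 : ℝ) : ℂ) • (fun p => (f b (a 0) (a 1) (a 2) p : ℂ)) := by
  rw [U_eq, sym_eq, Matrix.mulVec_smul]
  congr 1
  ext p
  rw [← Uz_w]
  simp [Matrix.mulVec, dotProduct]

end Sub15

/-- The 16 local unitaries `{I ⊗ v_a, Z ⊗ v_a}` locally encode `|4,2⟩`: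
`⟨4,2| (Z^b ⊗ v_a)† (Z^{b'} ⊗ v_{a'}) |4,2⟩ = δ_{bb'} δ_{aa'}`. -/
theorem stmt15 :
    ∀ (b b' : Fin 2) (a a' : Fin 3 → Fin 2),
      star sym42 ⬝ᵥ ((((Zg ^ (b : ℕ)) ⊗ₖ vEnc a)ᴴ * ((Zg ^ (b' : ℕ)) ⊗ₖ vEnc a')) *ᵥ sym42)
        = if b = b' ∧ a = a' then 1 else 0 := by
  intro b b' a a'
  rw [← Matrix.mulVec_mulVec, Matrix.dotProduct_mulVec, ← Matrix.star_mulVec,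
    Sub15.U_sym, Sub15.U_sym, star_smul, smul_dotProduct, dotProduct_smul]
  have h := congrArg (Int.cast : ℤ → ℂ)
    (Sub15.ff b (a 0) (a 1) (a 2) b' (a' 0) (a' 1) (a' 2))
  have ha : a = a' ↔ (a 0 = a' 0 ∧ a 1 = a' 1 ∧ a 2 = a' 2) := by
    rw [funext_iff, Fin.forall_fin_succ, Fin.forall_fin_succ, Fin.forall_fin_succ]
    simp
  have hd : star (fun p => (Sub15.f b (a 0) (a 1) (a 2) p : ℂ)) ⬝ᵥ
      (fun p => (Sub15.f b' (a' 0) (a' 1) (a' 2) p : ℂ)) =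
      if b = b' ∧ a = a' then 6 else 0 := by
    simp only [ha]
    push_cast at h
    rw [← h]
    simp [dotProduct]
  have h6 : ((1 / Real.sqrt 6 : ℝ) : ℂ) * ((1 / Real.sqrt 6 : ℝ) : ℂ) * 6 = 1 := by
    have : (1 / Real.sqrt 6) * (1 / Real.sqrt 6) * 6 = 1 := by
      have := Real.mul_self_sqrt (show (0:ℝ) ≤ 6 by norm_num)
      field_simp
      nlinarith
    exact_mod_cast this
  rw [hd]
  have hs : star ((1 / Real.sqrt 6 : ℝ) : ℂ) = ((1 / Real.sqrt 6 : ℝ) : ℂ) :=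
    Complex.conj_ofReal _
  rw [hs, smul_eq_mul, smul_eq_mul, ← mul_assoc]
  split_ifs
  · exact h6
  · simp
end
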